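/- The set of Borel measures on S^1 with density (with respect to normalized Haar measure) of the form t ↦ c·∏_{j=1}^n (1 - cos(t - θ_j)), with n ∈ ℕ, c ≥ 0 and θ_1, ..., θ_n ∈ [0, 2π), is dense in the set of all finite positive Borel measures on S^1 with respect to the weak* (vague) topology. -/

import Mathlib

open MeasureTheory Real
open scoped ENNReal

noncomputable instance : MeasurableSpace Circle := borel Circle
instance : BorelSpace Circle := ⟨rfl⟩

/-- The normalized Haar measure on the circle. -/
noncomputable def circleHaar : Measure Circle := Measure.haarMeasure ⊤


open Filter Topology

namespace S15

instance : Measure.IsHaarMeasure circleHaar := by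
  unfold circleHaar; infer_instance

instance : IsProbabilityMeasure circleHaar := ⟨by
  have := Measure.haarMeasure_self (K₀ := (⊤ : TopologicalSpace.PositiveCompacts Circle))
  simpa [circleHaar] using this⟩

lemma integrable_cont {E : Type*} [NormedAddCommGroup E] {f : Circle → E} (hf : Continuous f)
    (μ : Measure Circle) [IsFiniteMeasure μ] : Integrable f μ :=
  hf.integrable_of_hasCompactSupport (HasCompactSupport.of_compactSpace f)

/-- The finite measure with continuous density `f`. -/
noncomputable def Phi (f : C(Circle, ℝ)) : FiniteMeasure Circle :=
  ⟨circleHaar.withDensity (fun z => ENNReal.ofReal (f z)),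
    isFiniteMeasure_withDensity_ofReal (integrable_cont f.continuous circleHaar).2⟩

lemma integral_Phi (f : C(Circle, ℝ)) (hf : ∀ z, 0 ≤ f z) (g : Circle → ℝ) :
    ∫ z, g z ∂(Phi f : Measure Circle) = ∫ z, f z * g z ∂circleHaar := by
  have : (Phi f : Measure Circle) = circleHaar.withDensity (fun z => ENNReal.ofReal (f z)) := rfl
  rw [this, integral_withDensity_eq_integral_toReal_smul
    (f.continuous.measurable.ennreal_ofReal) (by simp)]
  simp [ENNReal.toReal_ofReal (hf _)]

lemma tendsto_Phi (F : ℕ → C(Circle, ℝ)) (f : C(Circle, ℝ)) (hF : ∀ n z, 0 ≤ F n z) (M : ℝ)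
    (hM : ∀ n z, F n z ≤ M) (h : ∀ z, Tendsto (fun n => F n z) atTop (𝓝 (f z))) :
    Tendsto (fun n => Phi (F n)) atTop (𝓝 (Phi f)) := by
  have hf : ∀ z, 0 ≤ f z := fun z => ge_of_tendsto' (h z) (fun n => hF n z)
  rw [FiniteMeasure.tendsto_iff_forall_integral_tendsto]
  intro g
  simp_rw [integral_Phi _ (hF _), integral_Phi _ hf]
  apply tendsto_integral_of_dominated_convergence (fun _ => M * ‖g‖)
  · intro n
    exact ((F n).continuous.mul g.continuous).aestronglyMeasurable
  · exact integrable_const _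
  · intro n
    refine ae_of_all _ fun z => ?_
    rw [norm_mul, Real.norm_of_nonneg (hF n z)]
    exact mul_le_mul (hM n z) (g.norm_coe_le_norm z) (norm_nonneg _) ((hF n z).trans (hM n z))
  · exact ae_of_all _ fun z => (h z).mul tendsto_const_nhds

/-- Riemann-Lebesgue on the circle. -/
lemma riemann_lebesgue (f : C(Circle, ℂ)) :
    Tendsto (fun n : ℕ => ∫ z : Circle, (z : ℂ) ^ n * f z ∂circleHaar) atTop (𝓝 0) := by
  let w : ℕ → Circle := fun n => Circle.exp (π / n)
  have hw : Tendsto w atTop (𝓝 1) := by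
    have : Tendsto (fun n : ℕ => π / n) atTop (𝓝 0) := tendsto_const_div_atTop_nhds_zero_nat π
    have h2 := (Circle.exp.continuous.tendsto 0).comp this
    simpa [Function.comp_def, w] using h2
  have hwn : ∀ n : ℕ, n ≠ 0 → ((w n : Circle) : ℂ) ^ n = -1 := by
    intro n hn
    have : (n : ℂ) ≠ 0 := by exact_mod_cast hn
    simp only [w, Circle.coe_exp]
    rw [← Complex.exp_nat_mul, ← Complex.exp_pi_mul_I]
    congr 1
    push_cast
    field_simp
  have key : ∀ n : ℕ, n ≠ 0 → ∫ z : Circle, (z : ℂ) ^ n * f z ∂circleHaar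
      = (1/2) * ∫ z : Circle, (z : ℂ) ^ n * (f z - f (w n * z)) ∂circleHaar := by
    intro n hn
    have h1 := integral_mul_left_eq_self (μ := circleHaar)
      (fun z : Circle => (z : ℂ) ^ n * f z) (w n)
    have h2 : ∀ z : Circle, ((w n * z : Circle) : ℂ) ^ n * f (w n * z)
        = - ((z : ℂ) ^ n * f (w n * z)) := by
      intro z
      rw [Circle.coe_mul, mul_pow, hwn n hn]; ring
    simp_rw [h2] at h1
    rw [integral_neg] at h1
    simp_rw [mul_sub]
    rw [integral_sub (integrable_cont (by fun_prop) _) (integrable_cont (by fun_prop) _), ← h1]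
    ring
  have h3 : Tendsto (fun n : ℕ => ∫ z : Circle, (z : ℂ) ^ n * (f z - f (w n * z)) ∂circleHaar)
      atTop (𝓝 (∫ z : Circle, (0 : ℂ) ∂circleHaar)) := by
    apply tendsto_integral_of_dominated_convergence (fun _ => ‖f‖ + ‖f‖)
    · intro n
      exact Continuous.aestronglyMeasurable (by fun_prop)
    · exact integrable_const _
    · intro n
      refine ae_of_all _ fun z => ?_
      simp only [norm_mul, norm_pow, Circle.norm_coe, one_pow, one_mul]
      exact (norm_sub_le _ _).trans (add_le_add (f.norm_coe_le_norm _) (f.norm_coe_le_norm _))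
    · refine ae_of_all _ fun z => ?_
      rw [tendsto_zero_iff_norm_tendsto_zero]
      simp only [norm_mul, norm_pow, Circle.norm_coe, one_pow, one_mul]
      have : Tendsto (fun n => f (w n * z)) atTop (𝓝 (f (1 * z))) :=
        (f.continuous.tendsto _).comp (hw.mul tendsto_const_nhds)
      have h4 := (tendsto_const_nhds (x := f z)).sub this
      simpa using h4.norm
  have h5 := h3.const_mul (1/2)
  simp only [integral_zero, mul_zero] at h5
  refine h5.congr' ?_
  filter_upwards [eventually_ne_atTop 0] with n hn
  exact (key n hn).symm

open Polynomial in
lemma exists_factor (p : ℂ[X]) : ∃ (n : ℕ) (a : ℂ) (r : Fin n → ℂ),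
    p = C a * ∏ j, (X - C (r j)) := by
  have h := (IsAlgClosed.splits p).eq_prod_roots
  refine ⟨p.roots.toList.length, p.leadingCoeff, fun j => p.roots.toList[j], ?_⟩
  conv_lhs => rw [h]
  congr 1
  conv_lhs => rw [← Multiset.coe_toList p.roots]
  rw [Multiset.map_coe, Multiset.prod_coe]
  exact (Fin.prod_univ_fun_getElem p.roots.toList (fun x => X - C x)).symm

lemma exists_theta (w : ℂ) (hw : ‖w‖ = 1) :
    ∃ θ ∈ Set.Ico (0 : ℝ) (2 * π), Complex.exp (θ * Complex.I) = w := by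
  refine ⟨toIcoMod Real.two_pi_pos 0 (Complex.arg w), by
    simpa using toIcoMod_mem_Ico Real.two_pi_pos 0 (Complex.arg w), ?_⟩
  have : toIcoMod Real.two_pi_pos 0 (Complex.arg w)
    = Complex.arg w - toIcoDiv Real.two_pi_pos 0 (Complex.arg w) * (2 * π) := by
    rw [toIcoMod]; simp
  rw [this]
  push_cast
  rw [sub_mul, Complex.exp_sub]
  have h1 := Complex.norm_mul_exp_arg_mul_I w
  rw [hw] at h1
  have h2 := Complex.exp_int_mul_two_pi_mul_I (toIcoDiv Real.two_pi_pos 0 (Complex.arg w))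
  rw [mul_assoc, h2]
  simpa using h1

lemma normSq_aux (z a : ℂ) : Complex.normSq (z - a) - Complex.normSq (1 - (starRingEnd ℂ) a * z)
    = (1 - Complex.normSq z) * (Complex.normSq a - 1) := by
  simp [Complex.normSq_apply]; ring

/-- The target set. -/
def S : Set (FiniteMeasure Circle) := {μ : FiniteMeasure Circle |
      ∃ (n : ℕ) (c : ℝ) (θ : Fin n → ℝ), 0 ≤ c ∧ (∀ j, θ j ∈ Set.Ico (0 : ℝ) (2 * π)) ∧
        (μ : Measure Circle) = circleHaar.withDensity
          (fun z => ENNReal.ofReal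
            (c * ∏ j, (1 - ((z : ℂ) * (starRingEnd ℂ) (Complex.exp (θ j * Complex.I))).re)))}

/-- The squared modulus of a polynomial on the circle. -/
noncomputable def sq (p : Polynomial ℂ) : C(Circle, ℝ) :=
  ⟨fun z => Complex.normSq (p.eval (z : ℂ)), by
    exact Complex.continuous_normSq.comp (p.continuous.comp continuous_subtype_val)⟩

lemma sq_mem (p : Polynomial ℂ) (h : ∀ z : ℂ, ‖z‖ ≠ 1 → p.eval z ≠ 0) (c : ℝ) (hc : 0 ≤ c) :
    Phi (c • sq p) ∈ S := by
  obtain ⟨n, a, r, hp⟩ := exists_factor p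
  have hr : ∀ j, ‖r j‖ = 1 := by
    intro j
    by_contra hj
    apply h _ hj
    rw [hp, Polynomial.eval_mul, Polynomial.eval_prod]
    rw [Finset.prod_eq_zero (Finset.mem_univ j)] <;> simp
  choose θ h1 h2 using fun j => exists_theta (r j) (hr j)
  refine ⟨n, c * Complex.normSq a * 2 ^ n, θ, by have := Complex.normSq_nonneg a; positivity, h1, ?_⟩
  change circleHaar.withDensity _ = _
  congr 1
  funext z
  congr 1
  simp only [h2]
  have h3 : ∀ j, Complex.normSq ((z : ℂ) - r j) = 2 * (1 - ((z : ℂ) * (starRingEnd ℂ) (r j)).re) := by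
    intro j
    rw [Complex.normSq_sub, Complex.normSq_eq_norm_sq, Complex.normSq_eq_norm_sq, hr, Circle.norm_coe]
    simp; ring
  simp only [sq, ContinuousMap.smul_apply, ContinuousMap.coe_mk, smul_eq_mul]
  rw [hp, Polynomial.eval_mul, Polynomial.eval_prod, map_mul, map_prod]
  simp only [Polynomial.eval_sub, Polynomial.eval_X, Polynomial.eval_C, h3, Finset.prod_mul_distrib]
  simp; ring


open Polynomial in
/-- The reciprocal polynomial, by its properties. -/
lemma exists_recip (q : ℂ[X]) (hq : ∀ z : ℂ, ‖z‖ ≤ 1 → q.eval z ≠ 0) :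
    ∃ s : ℂ[X], (∀ z, ‖z‖ < 1 → Complex.normSq (s.eval z) ≤ Complex.normSq (q.eval z)) ∧
      (∀ z, ‖z‖ = 1 → Complex.normSq (s.eval z) = Complex.normSq (q.eval z)) ∧
      (∀ z, 1 < ‖z‖ → Complex.normSq (q.eval z) ≤ Complex.normSq (s.eval z)) ∧
      (∀ z, 1 < ‖z‖ → s.eval z ≠ 0) := by
  obtain ⟨n, a, r, hp⟩ := exists_factor q
  have ha : a ≠ 0 := by
    rintro rfl
    exact hq 0 (by simp) (by rw [hp]; simp)
  have hr : ∀ j, 1 < Complex.normSq (r j) := by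
    intro j
    by_contra hj
    rw [Complex.normSq_eq_norm_sq] at hj
    apply hq (r j) (by nlinarith [norm_nonneg (r j)])
    rw [hp, eval_mul, eval_prod]
    rw [Finset.prod_eq_zero (Finset.mem_univ j)] <;> simp
  have e1 : ∀ z, Complex.normSq (q.eval z) = Complex.normSq a * ∏ j, Complex.normSq (z - r j) := by
    intro z
    rw [hp, eval_mul, eval_prod, map_mul, map_prod]; simp
  have e2 : ∀ z, Complex.normSq ((C a * ∏ j, (1 - C ((starRingEnd ℂ) (r j)) * X)).eval z)
      = Complex.normSq a * ∏ j, Complex.normSq (1 - (starRingEnd ℂ) (r j) * z) := by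
    intro z
    rw [eval_mul, eval_prod, map_mul, map_prod]; simp
  refine ⟨C a * ∏ j, (1 - C ((starRingEnd ℂ) (r j)) * X), ?_, ?_, ?_, ?_⟩
  · intro z hz
    rw [e1, e2]
    have : Complex.normSq z < 1 := by
      rw [Complex.normSq_eq_norm_sq]; nlinarith [norm_nonneg z]
    refine mul_le_mul_of_nonneg_left ?_ (Complex.normSq_nonneg _)
    refine Finset.prod_le_prod (fun j _ => Complex.normSq_nonneg _) fun j _ => ?_
    nlinarith [normSq_aux z (r j), hr j]
  · intro z hz
    rw [e1, e2]
    have : Complex.normSq z = 1 := by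
      rw [Complex.normSq_eq_norm_sq, hz]; simp
    congr 1
    refine Finset.prod_congr rfl fun j _ => ?_
    have := normSq_aux z (r j)
    simp_all
    linarith
  · intro z hz
    rw [e1, e2]
    have : 1 < Complex.normSq z := by
      rw [Complex.normSq_eq_norm_sq]; nlinarith [norm_nonneg z]
    refine mul_le_mul_of_nonneg_left ?_ (Complex.normSq_nonneg _)
    refine Finset.prod_le_prod (fun j _ => Complex.normSq_nonneg _) fun j _ => ?_
    nlinarith [normSq_aux z (r j), hr j]
  · intro z hz h0
    have h1 := e2 z
    rw [h0, map_zero, eq_comm, mul_eq_zero, Finset.prod_eq_zero_iff] at h1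
    rcases h1 with h1 | ⟨j, -, h1⟩
    · exact ha (by simpa using h1)
    · rw [Complex.normSq_eq_zero, sub_eq_zero] at h1
      have h2 := congrArg (fun x => ‖x‖) h1
      simp only [norm_one, norm_mul, RCLike.norm_conj] at h2
      have h3 := hr j
      rw [Complex.normSq_eq_norm_sq] at h3
      have : 1 < ‖r j‖ := by nlinarith [norm_nonneg (r j)]
      nlinarith

open Polynomial in
lemma sq_closure (q : ℂ[X]) (hq : ∀ z : ℂ, ‖z‖ ≤ 1 → q.eval z ≠ 0) :
    Phi (sq q) ∈ closure S := by
  obtain ⟨s, h1, h2, h3, h4⟩ := exists_recip q hq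
  let p : ℕ → ℂ[X] := fun n => X ^ (n + 1) * s + q
  have hp : ∀ n, Phi ((1/2 : ℝ) • sq (p n)) ∈ S := by
    intro n
    apply sq_mem _ _ _ (by norm_num)
    intro z hz h0
    have h5 : z ^ (n + 1) * s.eval z = - q.eval z := by
      have : z ^ (n + 1) * s.eval z + q.eval z = 0 := by simpa [p] using h0
      linear_combination this
    have h6 := congrArg Complex.normSq h5
    rw [map_mul, Complex.normSq_neg, map_pow] at h6
    rcases lt_or_gt_of_ne hz with hz | hz
    · have hq0 : 0 < Complex.normSq (q.eval z) := Complex.normSq_pos.2 (hq z hz.le)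
      have : Complex.normSq z < 1 := by
        rw [Complex.normSq_eq_norm_sq]; nlinarith [norm_nonneg z]
      have := pow_lt_one₀ (Complex.normSq_nonneg z) this (Nat.succ_ne_zero n)
      have h9 := mul_le_mul_of_nonneg_left (h1 z hz) (pow_nonneg (Complex.normSq_nonneg z) (n + 1))
      have h10 := mul_lt_mul_of_pos_right this hq0
      rw [Nat.succ_eq_add_one, one_mul] at h10
      linarith
    · have hq0 : 0 < Complex.normSq (s.eval z) := Complex.normSq_pos.2 (h4 z hz)
      have : 1 < Complex.normSq z := by
        rw [Complex.normSq_eq_norm_sq]; nlinarith [norm_nonneg z]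
      have := one_lt_pow₀ this (Nat.succ_ne_zero n)
      have h10 := mul_lt_mul_of_pos_right this hq0
      rw [Nat.succ_eq_add_one, one_mul, h6] at h10
      linarith [h3 z hz]
  refine mem_closure_of_tendsto (f := fun n => Phi ((1/2 : ℝ) • sq (p n))) (b := atTop) ?_
    (Eventually.of_forall hp)
  rw [FiniteMeasure.tendsto_iff_forall_integral_tendsto]
  intro g
  have n1 : ∀ n z, 0 ≤ ((1/2 : ℝ) • sq (p n)) z := by
    intro n z
    have := Complex.normSq_nonneg ((p n).eval (z : ℂ))
    simp only [sq, ContinuousMap.smul_apply, ContinuousMap.coe_mk, smul_eq_mul]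
    positivity
  have n2 : ∀ z, 0 ≤ sq q z := fun z => Complex.normSq_nonneg _
  simp_rw [integral_Phi _ (n1 _), integral_Phi _ n2]
  have cs : Continuous fun z : Circle => s.eval (z : ℂ) := s.continuous.comp continuous_subtype_val
  have cq : Continuous fun z : Circle => q.eval (z : ℂ) := q.continuous.comp continuous_subtype_val
  have cz : Continuous fun z : Circle => (z : ℂ) := continuous_subtype_val
  have cc : Continuous fun z : Circle => (starRingEnd ℂ) (q.eval (z : ℂ)) :=
    Complex.continuous_conj.comp cq
  have cg : Continuous fun z : Circle => ((g z : ℝ) : ℂ) :=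
    Complex.continuous_ofReal.comp g.continuous
  let F : C(Circle, ℂ) := ⟨fun z => s.eval (z : ℂ) * (starRingEnd ℂ) (q.eval (z : ℂ)) * (g z : ℂ),
    (cs.mul cc).mul cg⟩
  have key : ∀ n, ∫ z, ((1/2 : ℝ) • sq (p n)) z * g z ∂circleHaar
      = ∫ z, sq q z * g z ∂circleHaar + (∫ z, (z : ℂ) ^ (n + 1) * F z ∂circleHaar).re := by
    intro n
    have i2 : Integrable (fun z : Circle => (z : ℂ) ^ (n + 1) * F z) circleHaar :=
      integrable_cont ((cz.pow _).mul F.continuous) _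
    have := integral_re i2
    simp only [RCLike.re_to_complex] at this
    have i3 : Integrable (fun z : Circle => ((z : ℂ) ^ (n + 1) * F z).re) circleHaar :=
      integrable_cont (Complex.continuous_re.comp ((cz.pow _).mul F.continuous)) _
    have i4 : Integrable (fun z : Circle => sq q z * g z) circleHaar :=
      integrable_cont ((sq q).continuous.mul g.continuous) _
    rw [← this, ← integral_add i4 i3]
    congr 1
    funext z
    have e1 : Complex.normSq ((z : ℂ) ^ (n + 1) * s.eval (z : ℂ)) = Complex.normSq (q.eval (z : ℂ)) := by
      rw [map_mul, map_pow, h2 _ (Circle.norm_coe z)]; simp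
    have e2 : (p n).eval (z : ℂ) = (z : ℂ) ^ (n + 1) * s.eval (z : ℂ) + q.eval (z : ℂ) := by simp [p]
    have e3 : (z : ℂ) ^ (n + 1) * F z = ((z : ℂ) ^ (n + 1) * s.eval (z : ℂ)
      * (starRingEnd ℂ) (q.eval (z : ℂ))) * (g z : ℂ) := by
      simp only [F, ContinuousMap.coe_mk]; ring
    rw [e3, Complex.re_mul_ofReal]
    simp only [sq, ContinuousMap.smul_apply, ContinuousMap.coe_mk, smul_eq_mul]
    rw [e2, Complex.normSq_add, e1]
    ring
  simp_rw [key]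
  have h7 := (tendsto_add_atTop_iff_nat 1).2 (riemann_lebesgue F)
  have h8 := (Complex.continuous_re.tendsto 0).comp h7
  simpa using h8.const_add (∫ z, sq q z * g z ∂circleHaar)

/-- `exp h` for continuous `h`. -/
noncomputable def ex (h : C(Circle, ℝ)) : C(Circle, ℝ) :=
  ⟨fun z => Real.exp (h z), Real.continuous_exp.comp h.continuous⟩

/-- The real part of a polynomial. -/
noncomputable def reP (P : Polynomial ℂ) : C(Circle, ℝ) :=
  ⟨fun z => (P.eval (z : ℂ)).re,
    Complex.continuous_re.comp (P.continuous.comp continuous_subtype_val)⟩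

open Polynomial in
lemma ex_reP (P : ℂ[X]) : Phi (ex (reP P)) ∈ closure S := by
  obtain ⟨M, hM⟩ := (isCompact_closedBall (0 : ℂ) 1).exists_bound_of_continuousOn
    (P.continuous.continuousOn)
  have hM' : ∀ z : ℂ, ‖z‖ ≤ 1 → ‖P.eval z‖ ≤ M := fun z hz => hM z (by simpa using hz)
  have hM0 : 0 ≤ M := (norm_nonneg _).trans (hM' 0 (by simp))
  let q : ℕ → ℂ[X] := fun n => (1 + C (1 / (2 * (n : ℂ))) * P) ^ n
  have hqe : ∀ n z, (q n).eval z = (1 + (P.eval z / 2) / n) ^ n := by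
    intro n z
    simp only [q, eval_pow, eval_add, eval_one, eval_mul, eval_C]
    congr 2
    rw [div_div]; ring
  have hb : ∀ (n : ℕ) (z : ℂ), ‖z‖ ≤ 1 → ‖(P.eval z / 2) / (n : ℂ)‖ ≤ M / n := by
    intro n z hz
    rw [norm_div, norm_div]
    simp only [RCLike.norm_natCast, RCLike.norm_ofNat]
    gcongr
    linarith [hM' z hz, norm_nonneg (P.eval z)]
  refine isClosed_closure.mem_of_tendsto (f := fun n => Phi (sq (q n))) (b := atTop)
    (tendsto_Phi _ _ (fun n z => Complex.normSq_nonneg _) (Real.exp M ^ 2) ?_ ?_) ?_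
  · intro n z
    simp only [sq, ContinuousMap.coe_mk]
    rw [Complex.normSq_eq_norm_sq, hqe, norm_pow]
    gcongr
    calc _ ≤ (1 + M / n) ^ n := by
          gcongr
          refine (norm_add_le _ _).trans ?_
          rw [norm_one]
          gcongr
          exact hb n z (Circle.norm_coe z).le
      _ ≤ (Real.exp (M / n)) ^ n := by
          gcongr
          linarith [Real.add_one_le_exp (M / n)]
      _ ≤ Real.exp M := by
          rw [← Real.exp_nat_mul]
          apply Real.exp_le_exp.2
          rcases eq_or_ne n 0 with rfl | hn
          · simpa using hM0
          · have : (n : ℝ) ≠ 0 := by exact_mod_cast hn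
            field_simp
            rfl
  · intro z
    have h1 := Complex.tendsto_one_add_div_pow_exp (P.eval (z : ℂ) / 2)
    have h2 := (Complex.continuous_normSq.tendsto _).comp h1
    have h3 : ex (reP P) z = Complex.normSq (Complex.exp (P.eval (z : ℂ) / 2)) := by
      simp only [ex, reP, ContinuousMap.coe_mk]
      rw [Complex.normSq_eq_norm_sq, Complex.norm_exp, ← Real.exp_nat_mul]
      congr 1
      simp
      ring
    rw [h3]
    refine h2.congr fun n => ?_
    simp only [sq, ContinuousMap.coe_mk, hqe, Function.comp]
  · obtain ⟨N, hN⟩ := exists_nat_gt M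
    filter_upwards [eventually_ge_atTop N, eventually_gt_atTop 0] with n hn hn0
    apply sq_closure
    intro z hz h0
    rw [hqe] at h0
    have h1 := eq_zero_of_pow_eq_zero h0
    have h2 : (P.eval z / 2) / (n : ℂ) = -1 := by linear_combination h1
    have h3 := hb n z hz
    rw [h2, norm_neg, norm_one] at h3
    have hn1 : (0 : ℝ) < n := by exact_mod_cast hn0
    have hn2 : (N : ℝ) ≤ n := by exact_mod_cast hn
    rw [le_div_iff₀ hn1] at h3
    linarith

open Polynomial in
lemma reP_dense (h : C(Circle, ℝ)) (ε : ℝ) (hε : 0 < ε) :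
    ∃ P : ℂ[X], ∀ z, |reP P z - h z| < ε := by
  have : Fact (0 < 2 * π) := ⟨Real.two_pi_pos⟩
  have hne : (2 * π) ≠ 0 := Real.two_pi_pos.ne'
  let e := AddCircle.homeomorphCircle hne
  let G : C(AddCircle (2 * π), ℂ) := ⟨fun x => ((h (e x) : ℝ) : ℂ),
    Complex.continuous_ofReal.comp (h.continuous.comp e.continuous)⟩
  have hG : G ∈ closure (Submodule.span ℂ (Set.range (@fourier (2 * π))) : Set _) := by
    rw [← Submodule.topologicalClosure_coe, span_fourier_closure_eq_top]; trivial
  rw [Metric.mem_closure_iff] at hG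
  obtain ⟨f, hf, hd⟩ := hG ε hε
  have claim : ∀ f ∈ Submodule.span ℂ (Set.range (@fourier (2 * π))), ∀ c : ℂ,
      ∃ P : ℂ[X], ∀ x, (c * f x).re = (P.eval ((e x : Circle) : ℂ)).re := by
    intro f hf
    induction hf using Submodule.span_induction with
    | mem f hf =>
      obtain ⟨n, rfl⟩ := hf
      intro c
      have hp : ∀ (m : ℕ) (x : AddCircle (2 * π)), fourier (m : ℤ) x = ((e x : Circle) : ℂ) ^ m := by
        intro m x
        rw [fourier_apply, AddCircle.toCircle_zsmul, AddCircle.homeomorphCircle_apply]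
        simp
      rcases n with m | m
      · refine ⟨C c * X ^ m, fun x => ?_⟩
        rw [Int.ofNat_eq_natCast, hp]; simp
      · refine ⟨C ((starRingEnd ℂ) c) * X ^ (m + 1), fun x => ?_⟩
        rw [Int.negSucc_eq, fourier_neg]
        have := hp (m + 1) x
        push_cast at this
        rw [this, ← Complex.conj_re]
        simp only [eval_mul, eval_C, eval_pow, eval_X, map_mul, Complex.conj_conj]
    | zero => intro c; exact ⟨0, by simp⟩
    | add f g _ _ h1 h2 =>
      intro c
      obtain ⟨P, hP⟩ := h1 c
      obtain ⟨Q, hQ⟩ := h2 c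
      refine ⟨P + Q, fun x => ?_⟩
      rw [eval_add, Complex.add_re, ← hP, ← hQ, ContinuousMap.add_apply, mul_add, Complex.add_re]
    | smul a f _ h1 =>
      intro c
      obtain ⟨P, hP⟩ := h1 (c * a)
      refine ⟨P, fun x => ?_⟩
      rw [← hP, ContinuousMap.smul_apply, smul_eq_mul, mul_assoc]
  obtain ⟨P, hP⟩ := claim f hf 1
  refine ⟨P, fun z => ?_⟩
  have h1 := hP (e.symm z)
  rw [one_mul, e.apply_symm_apply] at h1
  have h2 := (ContinuousMap.dist_apply_le_dist (f := G) (g := f) (e.symm z)).trans_lt hd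
  rw [dist_comm, Complex.dist_eq] at h2
  refine lt_of_le_of_lt ?_ h2
  refine le_trans (le_of_eq ?_) (Complex.abs_re_le_norm _)
  rw [Complex.sub_re, h1]
  simp [G, reP]

lemma ex_mem (h : C(Circle, ℝ)) : Phi (ex h) ∈ closure S := by
  choose P hP using fun n : ℕ => reP_dense h (1 / ((n : ℝ) + 1)) (by positivity)
  refine isClosed_closure.mem_of_tendsto (f := fun n => Phi (ex (reP (P n)))) (b := atTop)
    (tendsto_Phi _ _ (fun n z => (Real.exp_pos _).le) (Real.exp (‖h‖ + 1)) ?_ ?_)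
    (Eventually.of_forall fun n => ex_reP _)
  · intro n z
    apply Real.exp_le_exp.2
    have h1 := (abs_lt.1 (hP n z)).2
    have h2 : 1 / ((n : ℝ) + 1) ≤ 1 := by
      rw [div_le_one (by positivity)]; linarith [(Nat.cast_nonneg n : (0 : ℝ) ≤ n)]
    have h3 := (le_abs_self _).trans (h.norm_coe_le_norm z)
    linarith
  · intro z
    refine (Real.continuous_exp.tendsto _).comp ?_
    rw [tendsto_iff_norm_sub_tendsto_zero]
    exact squeeze_zero (fun n => norm_nonneg _) (fun n => (hP n z).le)
      tendsto_one_div_add_atTop_nhds_zero_nat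

lemma pos_mem (f : C(Circle, ℝ)) (hf : ∀ z, 0 < f z) : Phi f ∈ closure S := by
  have : f = ex ⟨fun z => Real.log (f z), f.continuous.log (fun z => (hf z).ne')⟩ := by
    ext z
    simp [ex, Real.exp_log (hf z)]
  rw [this]
  exact ex_mem _

lemma exists_bump (n : ℕ) : ∃ φ : C(Circle, ℝ), (∀ z, 0 ≤ φ z) ∧ ∫ z, φ z ∂circleHaar = 1 ∧
    ∀ z, 1 / ((n : ℝ) + 1) ≤ dist z 1 → φ z = 0 := by
  have c0 : Continuous fun z : Circle => max 0 (1 / ((n : ℝ) + 1) - dist z 1) := by fun_prop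
  have hn : (0 : ℝ) < 1 / ((n : ℝ) + 1) := by positivity
  have hI : 0 < ∫ z : Circle, max 0 (1 / ((n : ℝ) + 1) - dist z 1) ∂circleHaar := by
    apply c0.integral_pos_of_hasCompactSupport_nonneg_nonzero
      (HasCompactSupport.of_compactSpace _) (fun z => le_max_left _ _) (x := 1)
    rw [dist_self, sub_zero, max_eq_right hn.le]
    exact hn.ne'
  refine ⟨⟨fun z => (max 0 (1 / ((n : ℝ) + 1) - dist z 1)) /
    ∫ z : Circle, max 0 (1 / ((n : ℝ) + 1) - dist z 1) ∂circleHaar, c0.div_const _⟩, ?_, ?_, ?_⟩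
  · intro z
    exact div_nonneg (le_max_left _ _) hI.le
  · simp only [ContinuousMap.coe_mk]
    rw [integral_div, div_self hI.ne']
  · intro z hz
    simp only [ContinuousMap.coe_mk]
    rw [max_eq_left (by linarith), zero_div]

lemma mem_closure_all (μ : FiniteMeasure Circle) : μ ∈ closure S := by
  choose φ h0 h1 h2 using exists_bump
  have cont : ∀ n, Continuous fun z : Circle => ∫ w, φ n (z * w⁻¹) ∂(μ : Measure Circle) := by
    intro n
    refine continuous_of_dominated (bound := fun _ => ‖φ n‖) ?_ ?_ (integrable_const _) ?_
    · intro z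
      exact Continuous.aestronglyMeasurable (by fun_prop)
    · intro z
      exact ae_of_all _ fun w => (φ n).norm_coe_le_norm _
    · exact ae_of_all _ fun w => by fun_prop
  let f : ℕ → C(Circle, ℝ) := fun n =>
    ⟨fun z => ∫ w, φ n (z * w⁻¹) ∂(μ : Measure Circle) + 1 / ((n : ℝ) + 1),
      (cont n).add continuous_const⟩
  have fpos : ∀ n z, 0 < f n z := by
    intro n z
    have : 0 ≤ ∫ w, φ n (z * w⁻¹) ∂(μ : Measure Circle) := integral_nonneg fun w => h0 n _
    have h3 : (0 : ℝ) < 1 / ((n : ℝ) + 1) := by positivity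
    exact add_pos_of_nonneg_of_pos this h3
  refine isClosed_closure.mem_of_tendsto (f := fun n => Phi (f n)) (b := atTop) ?_
    (Eventually.of_forall fun n => pos_mem _ (fpos n))
  rw [FiniteMeasure.tendsto_iff_forall_integral_tendsto]
  intro g
  have gc := g.continuous
  have key : ∀ n, ∫ z, g z ∂(Phi (f n) : Measure Circle)
      = ∫ w, ∫ z, g (z * w) * φ n z ∂circleHaar ∂(μ : Measure Circle)
        + 1 / ((n : ℝ) + 1) * ∫ z, g z ∂circleHaar := by
    intro n
    rw [integral_Phi _ (fun z => (fpos n z).le)]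
    have e1 : ∀ z, f n z * g z = ∫ w, g z * φ n (z * w⁻¹) ∂(μ : Measure Circle)
        + 1 / ((n : ℝ) + 1) * g z := by
      intro z
      rw [integral_const_mul]
      simp only [f, ContinuousMap.coe_mk]
      ring
    have ci : Continuous fun z : Circle => ∫ w, g z * φ n (z * w⁻¹) ∂(μ : Measure Circle) := by
      simp_rw [integral_const_mul]
      exact gc.mul (cont n)
    simp_rw [e1]
    rw [integral_add (integrable_cont ci _) (integrable_cont (by fun_prop) _), integral_const_mul]
    congr 1
    rw [integral_integral_swap]
    · congr 1
      funext w
      have := integral_mul_right_eq_self (μ := circleHaar) (fun z => g z * φ n (z * w⁻¹)) w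
      rw [← this]
      simp
    · exact Continuous.integrable_of_hasCompactSupport (by fun_prop)
        (HasCompactSupport.of_compactSpace _)
  simp_rw [key]
  have t1 : Tendsto (fun n : ℕ => 1 / ((n : ℝ) + 1) * ∫ z, g z ∂circleHaar) atTop (𝓝 0) := by
    simpa using (tendsto_one_div_add_atTop_nhds_zero_nat (𝕜 := ℝ)).mul_const
      (∫ z, g z ∂circleHaar)
  have diff : ∀ n w, ∫ z, g (z * w) * φ n z ∂circleHaar - g w
      = ∫ z, (g (z * w) - g w) * φ n z ∂circleHaar := by
    intro n w
    simp_rw [sub_mul]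
    rw [integral_sub (integrable_cont (by fun_prop) _) (integrable_cont (by fun_prop) _),
      integral_const_mul, h1, mul_one]
  have t2 : Tendsto (fun n : ℕ => ∫ w, ∫ z, g (z * w) * φ n z ∂circleHaar ∂(μ : Measure Circle))
      atTop (𝓝 (∫ w, g w ∂(μ : Measure Circle))) := by
    apply tendsto_integral_of_dominated_convergence (fun _ => ‖g‖)
    · intro n
      refine Continuous.aestronglyMeasurable ?_
      refine continuous_of_dominated (bound := fun z => ‖g‖ * φ n z) ?_ ?_
        (integrable_cont (by fun_prop) _) ?_
      · intro z
        exact Continuous.aestronglyMeasurable (by fun_prop)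
      · intro w
        refine ae_of_all _ fun z => ?_
        rw [norm_mul, Real.norm_of_nonneg (h0 n z)]
        exact mul_le_mul_of_nonneg_right (g.norm_coe_le_norm _) (h0 n z)
      · exact ae_of_all _ fun w => by fun_prop
    · exact integrable_const _
    · intro n
      refine ae_of_all _ fun w => ?_
      have := norm_integral_le_of_norm_le (μ := circleHaar) (f := fun z => g (z * w) * φ n z)
        (g := fun z => ‖g‖ * φ n z) (integrable_cont (by fun_prop) _)
        (ae_of_all _ fun z => by
          rw [norm_mul, Real.norm_of_nonneg (h0 n z)]
          exact mul_le_mul_of_nonneg_right (g.norm_coe_le_norm _) (h0 n z))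
      rwa [integral_const_mul, h1, mul_one] at this
    · refine ae_of_all _ fun w => ?_
      rw [Metric.tendsto_atTop]
      intro ε hε
      have hc : Continuous fun z : Circle => g (z * w) := by fun_prop
      obtain ⟨δ, hδ, hd⟩ := Metric.continuous_iff.1 hc 1 (ε / 2) (by positivity)
      obtain ⟨N, hN⟩ := exists_nat_one_div_lt hδ
      refine ⟨N, fun n hn => ?_⟩
      rw [Real.dist_eq, diff]
      have := norm_integral_le_of_norm_le (μ := circleHaar) (f := fun z => (g (z * w) - g w) * φ n z)
        (g := fun z => (ε / 2) * φ n z) (integrable_cont (by fun_prop) _)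
        (ae_of_all _ fun z => by
          rw [norm_mul, Real.norm_of_nonneg (h0 n z)]
          rcases le_or_gt (1 / ((n : ℝ) + 1)) (dist z 1) with hz | hz
          · rw [h2 n z hz]; simp
          · refine mul_le_mul_of_nonneg_right ?_ (h0 n z)
            have h5 := hd z (hz.trans ((one_div_le_one_div_of_le (by positivity)
              (by have : (N : ℝ) ≤ n := by exact_mod_cast hn
                  linarith)).trans_lt hN))
            rw [one_mul, Real.dist_eq] at h5
            exact h5.le)
      rw [integral_const_mul, h1, mul_one] at this
      exact lt_of_le_of_lt this (by linarith)
  simpa using t2.add t1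

end S15

/-- The set of finite Borel measures on the circle whose density with respect to the
normalized Haar measure has the form `t ↦ c·∏_{j=1}^n (1 - cos(t - θ_j))`
(written intrinsically: `1 - cos(t - θ_j) = 1 - Re(z·conj e^{iθ_j})` for `z = e^{it}`)
is dense in the finite positive Borel measures on the circle with the weak* topology. -/
theorem stmt15 :
    Dense {μ : FiniteMeasure Circle |
      ∃ (n : ℕ) (c : ℝ) (θ : Fin n → ℝ), 0 ≤ c ∧ (∀ j, θ j ∈ Set.Ico (0 : ℝ) (2 * π)) ∧
        (μ : Measure Circle) = circleHaar.withDensity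
          (fun z => ENNReal.ofReal
            (c * ∏ j, (1 - ((z : ℂ) * (starRingEnd ℂ) (Complex.exp (θ j * Complex.I))).re)))} := by
  exact fun μ => S15.mem_closure_all μ
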